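/- In the regular TPAUC setting, assume ℓ is non-decreasing, C_ℓ-Lipschitz continuous and ρ_ℓ-weakly-convex, and for every example X the map w ↦ h_w(X) is C_h-Lipschitz continuous and ρ_h-smooth (continuously differentiable with ρ_h-Lipschitz gradient). Then: (i) f(g,s') = s' + (g − s')₊/α is jointly convex in (g,s'), non-decreasing in g, and Lipschitz continuous with constant at most √2/α; (ii) for all X_i ∈ S₊ and X_j ∈ S₋, the map w ↦ ℓ(h_w(X_j) − h_w(X_i)) is (4ρ_ℓC_h² + 2C_ℓρ_h)-weakly-convex, ψ_i(w,s_i) is ((4ρ_ℓC_h² + 2C_ℓρ_h)/β)-weakly-convex in the joint variable (w,s_i), and each per-sample estimator ψ_i(w,s_i;X_j) is (2 + (4 + 16C_ℓ²C_h²)/β²)^{1/2}-Lipschitz continuous in (w,s_i); (iii) F(w,s,s') = (1/n₊)·Σ_{X_i∈S₊} f(ψ_i(w,s_i), s') is ((4ρ_ℓC_h² + 2C_ℓρ_h)/(αβ))-weakly-convex in the joint variable (w,s,s'). -/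

import Mathlib

noncomputable section

/-- A real-valued function on a real inner product space is `ρ`-weakly convex if
adding `ρ/2 ‖·‖²` makes it convex. -/
def WeaklyConvex {E : Type*} [NormedAddCommGroup E] [InnerProductSpace ℝ E]
    (ρ : ℝ) (f : E → ℝ) : Prop :=
  ConvexOn ℝ Set.univ fun x => f x + ρ / 2 * ‖x‖ ^ 2

/-- A vector-valued function is `ρ`-weakly convex if each component is. -/
def WeaklyConvexVec {E : Type*} [NormedAddCommGroup E] [InnerProductSpace ℝ E]
    {m : ℕ} (ρ : ℝ) (g : E → EuclideanSpace ℝ (Fin m)) : Prop :=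
  ∀ j : Fin m, WeaklyConvex ρ fun x => g x j

/-- `f` is `C`-Lipschitz continuous. -/
def LipschitzC {E F : Type*} [NormedAddCommGroup E] [NormedAddCommGroup F]
    (C : ℝ) (f : E → F) : Prop :=
  ∀ x y, ‖f x - f y‖ ≤ C * ‖x - y‖

/-- A scalar function on `ℝ^m` is non-decreasing with respect to each coordinate
of the input. -/
def CoordNonDecreasing {m : ℕ} (f : EuclideanSpace ℝ (Fin m) → ℝ) : Prop :=
  ∀ (k : Fin m) (x : EuclideanSpace ℝ (Fin m)),
    Monotone fun t : ℝ => f (x + t • EuclideanSpace.single k (1 : ℝ))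

/-- A scalar function on `ℝ^m` is monotone: with respect to each coordinate of the
input it is either non-decreasing or non-increasing. -/
def CoordMonotone {m : ℕ} (f : EuclideanSpace ℝ (Fin m) → ℝ) : Prop :=
  ∀ k : Fin m,
    (∀ x, Monotone fun t : ℝ => f (x + t • EuclideanSpace.single k (1 : ℝ))) ∨
    (∀ x, Antitone fun t : ℝ => f (x + t • EuclideanSpace.single k (1 : ℝ)))

/-- A vector-valued function is non-decreasing if each component is non-decreasing
with respect to each coordinate of the input. -/
def CoordNonDecreasingVec {m₁ m₂ : ℕ}
    (g : EuclideanSpace ℝ (Fin m₁) → EuclideanSpace ℝ (Fin m₂)) : Prop :=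
  ∀ j : Fin m₂, CoordNonDecreasing fun x => g x j

/-- A vector-valued function is monotone if each component is monotone. -/
def CoordMonotoneVec {m₁ m₂ : ℕ}
    (g : EuclideanSpace ℝ (Fin m₁) → EuclideanSpace ℝ (Fin m₂)) : Prop :=
  ∀ j : Fin m₂, CoordMonotone fun x => g x j

/-- `f` is `L`-smooth: differentiable with `L`-Lipschitz derivative. -/
def SmoothL {E F : Type*} [NormedAddCommGroup E] [NormedSpace ℝ E]
    [NormedAddCommGroup F] [NormedSpace ℝ F] (L : ℝ) (f : E → F) : Prop :=
  Differentiable ℝ f ∧ ∀ x y, ‖fderiv ℝ f x - fderiv ℝ f y‖ ≤ L * ‖x - y‖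

/-- `v` is a general subgradient of `f` at `x`:
`f y ≥ f x + ⟪v, y - x⟫ + o(‖y - x‖)` as `y → x`. -/
def IsSubgradient {E : Type*} [NormedAddCommGroup E] [InnerProductSpace ℝ E]
    (f : E → ℝ) (x v : E) : Prop :=
  ∀ ε > 0, ∃ δ > 0, ∀ y, ‖y - x‖ < δ →
    f x + @inner ℝ _ _ v (y - x) - ε * ‖y - x‖ ≤ f y

/-- Weak convexity of a function of a joint variable `(w, s) ∈ E × ℝ`, with respect to
the Euclidean (ℓ²) structure on the product. -/
def WeaklyConvex2 {E : Type*} [NormedAddCommGroup E] [InnerProductSpace ℝ E]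
    (ρ : ℝ) (f : E → ℝ → ℝ) : Prop :=
  ConvexOn ℝ Set.univ fun p : E × ℝ => f p.1 p.2 + ρ / 2 * (‖p.1‖ ^ 2 + p.2 ^ 2)

/-- Weak convexity of a function of a joint variable `(w, s, s') ∈ E × ℝ^m × ℝ`, with
respect to the Euclidean (ℓ²) structure on the product. -/
def WeaklyConvex3 {E : Type*} [NormedAddCommGroup E] [InnerProductSpace ℝ E] {m : ℕ}
    (ρ : ℝ) (f : E → (Fin m → ℝ) → ℝ → ℝ) : Prop :=
  ConvexOn ℝ Set.univ fun p : E × (Fin m → ℝ) × ℝ =>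
    f p.1 p.2.1 p.2.2 + ρ / 2 * (‖p.1‖ ^ 2 + (∑ i, p.2.1 i ^ 2) + p.2.2 ^ 2)

/-- In an inner product space, the squared norm of a convex combination. -/
theorem norm_sq_convex_combo {E : Type*} [NormedAddCommGroup E] [InnerProductSpace ℝ E]
    {a b : ℝ} (hab : a + b = 1) (x y : E) :
    ‖a • x + b • y‖ ^ 2 = a * ‖x‖ ^ 2 + b * ‖y‖ ^ 2 - a * b * ‖x - y‖ ^ 2 := by
  rw [norm_add_sq_real, norm_sub_sq_real, norm_smul, norm_smul, real_inner_smul_left,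
    real_inner_smul_right, mul_pow, mul_pow, Real.norm_eq_abs, Real.norm_eq_abs, sq_abs, sq_abs]
  obtain rfl : b = 1 - a := by linarith
  ring

/-- Weak convexity as an approximate Jensen inequality. -/
theorem weaklyConvex_iff {E : Type*} [NormedAddCommGroup E] [InnerProductSpace ℝ E]
    {ρ : ℝ} {f : E → ℝ} :
    WeaklyConvex ρ f ↔ ∀ (x y : E) (a b : ℝ), 0 ≤ a → 0 ≤ b → a + b = 1 →
      f (a • x + b • y) ≤ a * f x + b * f y + ρ / 2 * (a * b * ‖x - y‖ ^ 2) := by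
  constructor
  · intro h x y a b ha hb hab
    have := h.2 (Set.mem_univ x) (Set.mem_univ y) ha hb hab
    simp only [norm_sq_convex_combo hab, smul_eq_mul] at this
    linarith
  · refine fun h => ⟨convex_univ, fun x _ y _ a b ha hb hab => ?_⟩
    have := h x y a b ha hb hab
    simp only [norm_sq_convex_combo hab, smul_eq_mul]
    linarith

/-- An `L`-smooth function is `L`-weakly convex. -/
theorem SmoothL.weaklyConvex {E : Type*} [NormedAddCommGroup E] [InnerProductSpace ℝ E]
    {L : ℝ} {u : E → ℝ} (hu : SmoothL L u) : WeaklyConvex L u := by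
  rw [weaklyConvex_iff]
  intro x y a b ha hb hab
  set v := y - x with hv
  have hd (t : ℝ) : HasDerivAt (fun t : ℝ => u (x + t • v) + L / 2 * ‖v‖ ^ 2 * t ^ 2)
      (fderiv ℝ u (x + t • v) v + L * ‖v‖ ^ 2 * t) t := by
    have hline : HasDerivAt (fun t : ℝ => x + t • v) v t := by
      simpa using ((hasDerivAt_id t).smul_const v).const_add x
    have hsq : HasDerivAt (fun t : ℝ => L / 2 * ‖v‖ ^ 2 * t ^ 2) (L * ‖v‖ ^ 2 * t) t := by
      refine ((hasDerivAt_pow 2 t).const_mul (L / 2 * ‖v‖ ^ 2)).congr_deriv ?_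
      push_cast
      ring
    exact ((hu.1 _).hasFDerivAt.comp_hasDerivAt t hline).add hsq
  have hconv := Monotone.convexOn_univ_of_deriv (fun t => (hd t).differentiableAt) (by
    intro s t hst
    rw [(hd s).deriv, (hd t).deriv]
    have h := (fderiv ℝ u (x + s • v) - fderiv ℝ u (x + t • v)).le_of_opNorm_le
      (hu.2 (x + s • v) (x + t • v)) v
    rw [add_sub_add_left_eq_sub, ← sub_smul, norm_smul, Real.norm_eq_abs (s - t),
      abs_of_nonpos (sub_nonpos.2 hst), sub_apply] at h
    have := (le_abs_self _).trans h
    linarith)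
  have h := hconv.2 (Set.mem_univ 0) (Set.mem_univ 1) ha hb hab
  have hz : x + b • v = a • x + b • y := by
    obtain rfl : a = 1 - b := by linarith
    rw [hv]
    module
  simp only [smul_eq_mul, mul_zero, zero_add, mul_one, zero_smul, add_zero, one_smul, hz] at h
  rw [show x + v = y by rw [hv]; abel] at h
  rw [norm_sub_rev x y, ← hv]
  obtain rfl : a = 1 - b := by linarith
  linarith

/-- Subtracting a smooth function from a smooth function. -/
theorem SmoothL.sub {E F : Type*} [NormedAddCommGroup E] [NormedSpace ℝ E]
    [NormedAddCommGroup F] [NormedSpace ℝ F] {L M : ℝ} {f g : E → F}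
    (hf : SmoothL L f) (hg : SmoothL M g) : SmoothL (L + M) fun x => f x - g x := by
  refine ⟨hf.1.sub hg.1, fun x y => ?_⟩
  rw [fderiv_fun_sub (hf.1 x) (hg.1 x), fderiv_fun_sub (hf.1 y) (hg.1 y), sub_sub_sub_comm, add_mul]
  exact (norm_sub_le _ _).trans (add_le_add (hf.2 x y) (hg.2 x y))

/-- Lipschitz constants add up under subtraction. -/
theorem LipschitzC.sub {E F : Type*} [NormedAddCommGroup E] [NormedAddCommGroup F]
    {C D : ℝ} {f g : E → F} (hf : LipschitzC C f) (hg : LipschitzC D g) :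
    LipschitzC (C + D) fun x => f x - g x := by
  intro x y
  rw [sub_sub_sub_comm, add_mul]
  exact (norm_sub_le _ _).trans (add_le_add (hf x y) (hg x y))

/-- A non-decreasing Lipschitz function increases by at most `C * δ` over a step `δ ≥ 0`. -/
theorem LipschitzC.le_add_of_le_add {C : ℝ} {ℓ : ℝ → ℝ} (hlip : LipschitzC C ℓ)
    (hmono : Monotone ℓ) {u v δ : ℝ} (hδ : 0 ≤ δ) (h : u ≤ v + δ) : ℓ u ≤ ℓ v + C * δ := by
  have h1 := hmono h
  have h2 := (le_abs_self _).trans (hlip (v + δ) v)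
  rw [add_sub_cancel_left, Real.norm_eq_abs, abs_of_nonneg hδ] at h2
  linarith

/-- Composing a non-decreasing, Lipschitz, weakly convex scalar function with a Lipschitz,
weakly convex function gives a weakly convex function. -/
theorem WeaklyConvex.comp {E : Type*} [NormedAddCommGroup E] [InnerProductSpace ℝ E]
    {C ρ D L : ℝ} {ℓ : ℝ → ℝ} {u : E → ℝ} (hℓ : WeaklyConvex ρ ℓ) (hmono : Monotone ℓ)
    (hlip : LipschitzC C ℓ) (hρ : 0 ≤ ρ) (hL : 0 ≤ L)
    (hu : WeaklyConvex L u) (hulip : LipschitzC D u) :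
    WeaklyConvex (ρ * D ^ 2 + C * L) fun x => ℓ (u x) := by
  rw [weaklyConvex_iff] at *
  intro x y a b ha hb hab
  have hstep := hlip.le_add_of_le_add hmono (by positivity) (hu x y a b ha hb hab)
  have hjensen := hℓ (u x) (u y) a b ha hb hab
  have hsq : ‖u x - u y‖ ^ 2 ≤ (D * ‖x - y‖) ^ 2 :=
    pow_le_pow_left₀ (norm_nonneg _) (hulip x y) 2
  have := mul_le_mul_of_nonneg_left hsq (by positivity : 0 ≤ ρ / 2 * (a * b))
  simp only [smul_eq_mul] at hjensen
  linarith

/-- Approximate Jensen inequality for `(u, s) ↦ s + (u - s)₊ / α`. -/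
theorem add_posPart_div_le_combo {α : ℝ} (hα : 0 < α) {a b u u₁ u₂ δ : ℝ} (s₁ s₂ : ℝ)
    (ha : 0 ≤ a) (hb : 0 ≤ b) (hδ : 0 ≤ δ) (hu : u ≤ a * u₁ + b * u₂ + δ) :
    (a * s₁ + b * s₂) + max (u - (a * s₁ + b * s₂)) 0 / α ≤
      a * (s₁ + max (u₁ - s₁) 0 / α) + b * (s₂ + max (u₂ - s₂) 0 / α) + δ / α := by
  have h : max (u - (a * s₁ + b * s₂)) 0 ≤
      a * max (u₁ - s₁) 0 + b * max (u₂ - s₂) 0 + δ := by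
    refine max_le ?_ (by positivity)
    have h₁ := mul_le_mul_of_nonneg_left (le_max_left (u₁ - s₁) 0) ha
    have h₂ := mul_le_mul_of_nonneg_left (le_max_left (u₂ - s₂) 0) hb
    linarith
  have := div_le_div_of_nonneg_right h hα.le
  simp only [add_div, mul_div_assoc] at this
  linarith

/-- `(u, s) ↦ s + (u - s)₊ / α` is `1/α`-Lipschitz for the `ℓ¹` norm when `α ≤ 1`. -/
theorem abs_add_posPart_div_sub_le {α : ℝ} (hα : 0 < α) (hα1 : α ≤ 1) (u s u' s' : ℝ) :
    |(s + max (u - s) 0 / α) - (s' + max (u' - s') 0 / α)| ≤ (|u - u'| + |s - s'|) / α := by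
  have hmax (u s : ℝ) : s + max (u - s) 0 / α = max (u - (1 - α) * s) (α * s) / α := by
    rw [← mul_div_cancel_left₀ s hα.ne', ← add_div, ← max_add_add_left,
      mul_div_cancel_left₀ s hα.ne']
    ring_nf
  rw [hmax, hmax, ← sub_div, abs_div, abs_of_pos hα]
  gcongr
  refine (abs_max_sub_max_le_max _ _ _ _).trans (max_le ?_ ?_)
  · calc |u - (1 - α) * s - (u' - (1 - α) * s')|
        = |(u - u') - (1 - α) * (s - s')| := by ring_nf
      _ ≤ |u - u'| + |(1 - α) * (s - s')| := abs_sub _ _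
      _ ≤ |u - u'| + |s - s'| := by
        rw [abs_mul, abs_of_nonneg (sub_nonneg.2 hα1)]
        gcongr
        exact mul_le_of_le_one_left (abs_nonneg _) (by linarith)
  · rw [← mul_sub, abs_mul, abs_of_pos hα]
    exact (mul_le_of_le_one_left (abs_nonneg _) hα1).trans (le_add_of_nonneg_left (abs_nonneg _))

/-- Averages preserve approximate Jensen inequalities. -/
theorem inv_mul_sum_le_combo {n : ℕ} (hn : 0 < n) {a b δ : ℝ} {f g h : Fin n → ℝ}
    (H : ∀ i, f i ≤ a * g i + b * h i + δ) :
    (n : ℝ)⁻¹ * ∑ i, f i ≤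
      a * ((n : ℝ)⁻¹ * ∑ i, g i) + b * ((n : ℝ)⁻¹ * ∑ i, h i) + δ := by
  have hn' : (n : ℝ) ≠ 0 := by positivity
  calc (n : ℝ)⁻¹ * ∑ i, f i ≤ (n : ℝ)⁻¹ * ∑ i, (a * g i + b * h i + δ) := by
        gcongr with i
        exact H i
    _ = _ := by
        simp only [Finset.sum_add_distrib, ← Finset.mul_sum, Finset.sum_const, Finset.card_univ,
          Fintype.card_fin, nsmul_eq_mul]
        field_simp

/-- Cauchy–Schwarz in the plane. -/
theorem mul_add_le_sqrt_mul_sqrt (K W S : ℝ) :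
    K * W + S ≤ √(K ^ 2 + 1) * √(W ^ 2 + S ^ 2) := by
  rw [← Real.sqrt_mul (by positivity)]
  exact Real.le_sqrt_of_sq_le (by nlinarith [sq_nonneg (K * S - W)])

/-- Lemma 17. Structural properties of the TPAUC objective in the
regular learning setting. -/
theorem tpauc_regular_weak_convexity
    (d npos nneg : ℕ) (hnpos : 0 < npos) (hnneg : 0 < nneg)
    (α β Cℓ ρℓ Ch ρh : ℝ)
    (hα : 0 < α) (hα1 : α ≤ 1) (hβ : 0 < β) (hβ1 : β ≤ 1)
    (hCℓ : 0 ≤ Cℓ) (hρℓ : 0 ≤ ρℓ) (hCh : 0 ≤ Ch) (hρh : 0 ≤ ρh)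
    (ℓ : ℝ → ℝ)
    (hℓmono : Monotone ℓ) (hℓlip : LipschitzC Cℓ ℓ) (hℓwc : WeaklyConvex ρℓ ℓ)
    (hp : Fin npos → EuclideanSpace ℝ (Fin d) → ℝ)
    (hm : Fin nneg → EuclideanSpace ℝ (Fin d) → ℝ)
    (hplip : ∀ i, LipschitzC Ch (hp i)) (hmlip : ∀ j, LipschitzC Ch (hm j))
    (hpsm : ∀ i, SmoothL ρh (hp i)) (hmsm : ∀ j, SmoothL ρh (hm j)) :
    -- (i) properties of f(g, s') = s' + (g − s')₊/α
    (ConvexOn ℝ Set.univ fun p : ℝ × ℝ => p.2 + max (p.1 - p.2) 0 / α) ∧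
    (∀ s' : ℝ, Monotone fun u : ℝ => s' + max (u - s') 0 / α) ∧
    (∀ u s' u' s'' : ℝ,
      |(s' + max (u - s') 0 / α) - (s'' + max (u' - s'') 0 / α)| ≤
        Real.sqrt 2 / α * Real.sqrt ((u - u') ^ 2 + (s' - s'') ^ 2)) ∧
    -- (ii) weak convexity of the pairwise losses and of ψ_i, and Lipschitz
    -- continuity of the per-sample estimators
    (∀ (i : Fin npos) (j : Fin nneg),
      WeaklyConvex (4 * ρℓ * Ch ^ 2 + 2 * Cℓ * ρh)
        fun w => ℓ (hm j w - hp i w)) ∧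
    (∀ i : Fin npos,
      WeaklyConvex2 ((4 * ρℓ * Ch ^ 2 + 2 * Cℓ * ρh) / β)
        fun w s => (nneg : ℝ)⁻¹ * ∑ j, (s + max (ℓ (hm j w - hp i w) - s) 0 / β)) ∧
    (∀ (i : Fin npos) (j : Fin nneg) (w w' : EuclideanSpace ℝ (Fin d)) (s s' : ℝ),
      |(s + max (ℓ (hm j w - hp i w) - s) 0 / β)
          - (s' + max (ℓ (hm j w' - hp i w') - s') 0 / β)| ≤
        Real.sqrt (2 + (4 + 16 * Cℓ ^ 2 * Ch ^ 2) / β ^ 2) *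
          Real.sqrt (‖w - w'‖ ^ 2 + (s - s') ^ 2)) ∧
    -- (iii) joint weak convexity of the full objective F(w, s, s')
    WeaklyConvex3 ((4 * ρℓ * Ch ^ 2 + 2 * Cℓ * ρh) / (α * β))
      (fun w s s' => (npos : ℝ)⁻¹ * ∑ i,
        (s' + max ((nneg : ℝ)⁻¹ *
          (∑ j, (s i + max (ℓ (hm j w - hp i w) - s i) 0 / β)) - s') 0 / α)) := by
  have hpair (i : Fin npos) (j : Fin nneg) :
      WeaklyConvex (4 * ρℓ * Ch ^ 2 + 2 * Cℓ * ρh) fun w => ℓ (hm j w - hp i w) := by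
    convert hℓwc.comp hℓmono hℓlip hρℓ (add_nonneg hρh hρh)
      ((hmsm j).sub (hpsm i)).weaklyConvex ((hmlip j).sub (hplip i)) using 1
    ring
  set ρ := 4 * ρℓ * Ch ^ 2 + 2 * Cℓ * ρh with hρ
  have hρ0 : 0 ≤ ρ := by positivity
  have hψ (i : Fin npos) (w w' : EuclideanSpace ℝ (Fin d)) (s s' a b : ℝ)
      (ha : 0 ≤ a) (hb : 0 ≤ b) (hab : a + b = 1) :=
    inv_mul_sum_le_combo hnneg fun j => add_posPart_div_le_combo hβ s s' ha hb
      (δ := ρ / 2 * (a * b * ‖w - w'‖ ^ 2)) (by positivity)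
      (weaklyConvex_iff.1 (hpair i j) w w' a b ha hb hab)
  refine ⟨⟨convex_univ, fun p _ q _ a b ha hb _ => ?_⟩, fun s' u v huv => ?_,
    fun u s' u' s'' => ?_, hpair, fun i => ⟨convex_univ, ?_⟩, fun i j w w' s s' => ?_,
    convex_univ, ?_⟩
  · simpa using add_posPart_div_le_combo hα p.2 q.2 ha hb le_rfl (add_zero _).ge
  · dsimp only
    gcongr
  · refine (abs_add_posPart_div_sub_le hα hα1 _ _ _ _).trans ?_
    rw [div_mul_eq_mul_div]
    gcongr
    have h := mul_add_le_sqrt_mul_sqrt 1 |u - u'| |s' - s''|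
    norm_num [sq_abs] at h
    exact h
  · rintro ⟨w, s⟩ - ⟨w', s'⟩ - a b ha hb hab
    have h := hψ i w w' s s' a b ha hb hab
    have hs := norm_sq_convex_combo hab s s'
    simp only [Real.norm_eq_abs, sq_abs, smul_eq_mul] at hs
    simp only [Prod.smul_mk, Prod.mk_add_mk, smul_eq_mul, norm_sq_convex_combo hab, hs]
    have : 0 ≤ ρ / β / 2 * (a * b * (s - s') ^ 2) := by positivity
    have e : ρ / 2 * (a * b * ‖w - w'‖ ^ 2) / β = ρ / β / 2 * (a * b * ‖w - w'‖ ^ 2) := by ring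
    rw [e] at h
    linarith
  · refine (abs_add_posPart_div_sub_le hβ hβ1 _ _ _ _).trans ?_
    have hu : |ℓ (hm j w - hp i w) - ℓ (hm j w' - hp i w')| ≤ 2 * Cℓ * Ch * ‖w - w'‖ :=
      calc _ ≤ Cℓ * ‖hm j w - hp i w - (hm j w' - hp i w')‖ := hℓlip _ _
        _ ≤ Cℓ * ((Ch + Ch) * ‖w - w'‖) := by
          gcongr
          exact (hmlip j).sub (hplip i) w w'
        _ = _ := by ring
    have hcs := mul_add_le_sqrt_mul_sqrt (2 * Cℓ * Ch) ‖w - w'‖ |s - s'|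
    rw [sq_abs] at hcs
    have hK : √((2 * Cℓ * Ch) ^ 2 + 1) / β ≤
        √(2 + (4 + 16 * Cℓ ^ 2 * Ch ^ 2) / β ^ 2) := by
      apply Real.le_sqrt_of_sq_le
      rw [div_pow, Real.sq_sqrt (by positivity)]
      refine le_add_of_nonneg_of_le zero_le_two ?_
      exact div_le_div_of_nonneg_right (by nlinarith [sq_nonneg (Cℓ * Ch)]) (sq_nonneg β)
    calc _ ≤ √((2 * Cℓ * Ch) ^ 2 + 1) * √(‖w - w'‖ ^ 2 + (s - s') ^ 2) / β := by
          gcongr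
          linarith
      _ = √((2 * Cℓ * Ch) ^ 2 + 1) / β * √(‖w - w'‖ ^ 2 + (s - s') ^ 2) := by ring
      _ ≤ _ := by gcongr
  · rintro ⟨w, s, t⟩ - ⟨w', s', t'⟩ - a b ha hb hab
    have h := inv_mul_sum_le_combo hnpos fun i => add_posPart_div_le_combo hα t t' ha hb
      (by positivity) (hψ i w w' (s i) (s' i) a b ha hb hab)
    have hsq (x y : ℝ) := norm_sq_convex_combo hab x y
    simp only [Real.norm_eq_abs, sq_abs, smul_eq_mul] at hsq
    have hsum : ∑ i, (a * s i + b * s' i) ^ 2 =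
        a * ∑ i, s i ^ 2 + b * ∑ i, s' i ^ 2 - a * b * ∑ i, (s i - s' i) ^ 2 := by
      simp only [hsq, Finset.sum_sub_distrib, Finset.sum_add_distrib, Finset.mul_sum]
    simp only [Prod.smul_mk, Prod.mk_add_mk, smul_eq_mul, Pi.add_apply, Pi.smul_apply,
      norm_sq_convex_combo hab, hsum, hsq t t']
    have : 0 ≤ ρ / (α * β) / 2 * (a * b * ((∑ i, (s i - s' i) ^ 2) + (t - t') ^ 2)) := by
      positivity
    have e : ρ / 2 * (a * b * ‖w - w'‖ ^ 2) / β / α =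
        ρ / (α * β) / 2 * (a * b * ‖w - w'‖ ^ 2) := by
      field_simp
    rw [e] at h
    linarith
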